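/- Lemma (quasi 2-cylinders): Let p ≥ 4 and let G be the quasi 2-cylinder obtained from the cylinder C_p □ P_2 by deleting the single vertex (u_0, v_1), where V(C_p) = {u_0,…,u_{p−1}} and V(P_2) = {v_0, v_1}. If p is odd, then for every T ⊆ V(G) satisfying condition P, G admits an acyclic T-odd orientation. If p is even, then for every T ⊆ V(G) satisfying conditions P, S and S̄, G admits an acyclic T-odd orientation. -/

import Mathlib

open SimpleGraph

section Defs

variable {V : Type*}

/-- An orientation of a simple graph: each edge gets exactly one direction. -/
structure GraphOrientation {V : Type*} (G : SimpleGraph V) where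
  dir : V → V → Prop
  dir_adj : ∀ u v, dir u v → G.Adj u v
  dir_choice : ∀ u v, G.Adj u v → (dir u v ↔ ¬ dir v u)

/-- An orientation is acyclic if there is no directed cycle, i.e. the transitive
closure of the arc relation is irreflexive. -/
def GraphOrientation.Acyclic {G : SimpleGraph V} (o : GraphOrientation G) : Prop :=
  Irreflexive (Relation.TransGen o.dir)

/-- In-degree of a vertex in an orientation. -/
noncomputable def GraphOrientation.indeg {G : SimpleGraph V} (o : GraphOrientation G)
    (v : V) : ℕ :=
  Set.ncard {u | o.dir u v}

/-- An orientation is `T`-odd if a vertex has odd in-degree iff it belongs to `T`. -/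
def GraphOrientation.IsTOdd {G : SimpleGraph V} (o : GraphOrientation G) (T : Set V) : Prop :=
  ∀ v, Odd (o.indeg v) ↔ v ∈ T

/-- `G` admits an acyclic `T`-odd orientation. -/
def HasAcyclicTOddOrientation (G : SimpleGraph V) (T : Set V) : Prop :=
  ∃ o : GraphOrientation G, o.Acyclic ∧ o.IsTOdd T

/-- Degree of a vertex. -/
noncomputable def vdeg (G : SimpleGraph V) (v : V) : ℕ := (G.neighborSet v).ncard

/-- Potential sources: `V \ T`. -/
def sourceSet (T : Set V) : Set V := Tᶜ

/-- Potential sinks. -/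
def sinkSet (G : SimpleGraph V) (T : Set V) : Set V :=
  {v | (v ∈ T ∧ Odd (vdeg G v)) ∨ (v ∉ T ∧ Even (vdeg G v))}

/-- Parity condition `𝒫`: `|E| + |T|` is even. -/
def CondP (G : SimpleGraph V) (T : Set V) : Prop :=
  Even (G.edgeSet.ncard + T.ncard)

/-- Source condition `𝒮`. -/
def CondS (G : SimpleGraph V) (T : Set V) : Prop :=
  (sourceSet T).Nonempty ∧
    ((sourceSet T).ncard = 1 → Nat.card V = 1 ∨ sourceSet T ≠ sinkSet G T)

/-- Sink condition `𝒮̄`. -/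
def CondSbar (G : SimpleGraph V) (T : Set V) : Prop :=
  (sinkSet G T).Nonempty ∧
    ((sinkSet G T).ncard = 1 → Nat.card V = 1 ∨ sinkSet G T ≠ sourceSet T)

/-- Membership in the class `C_P`. -/
def MemCP (G : SimpleGraph V) : Prop :=
  ∀ T : Set V, CondP G T → HasAcyclicTOddOrientation G T

/-- Membership in the class `C_{P,S}`. -/
def MemCPS (G : SimpleGraph V) : Prop :=
  ∀ T : Set V, CondP G T → CondS G T → HasAcyclicTOddOrientation G T

/-- Membership in the class `C_{P,S̄}`. -/
def MemCPSbar (G : SimpleGraph V) : Prop :=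
  ∀ T : Set V, CondP G T → CondSbar G T → HasAcyclicTOddOrientation G T

/-- Membership in the class `C_{P,S,S̄}`. -/
def MemCPSSbar (G : SimpleGraph V) : Prop :=
  ∀ T : Set V, CondP G T → CondS G T → CondSbar G T → HasAcyclicTOddOrientation G T

/-- A graph is Eulerian if it is connected and every vertex has even degree. -/
def IsEulerianGraph (G : SimpleGraph V) : Prop :=
  G.Connected ∧ ∀ v : V, Even (vdeg G v)

end Defs

/-- Some ranking of the vertices of `S` orients the graph induced on `S` (from lower to higher
rank) with in-degrees of the prescribed parities. -/
def Realizable {W : Type*} (G : SimpleGraph W) (S : Finset W) (t : W → ZMod 2) : Prop :=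
  open Classical in
  ∃ r : W → ℤ, Set.InjOn r S ∧
    ∀ v ∈ S, ((S.filter fun u => G.Adj u v ∧ r u < r v).card : ZMod 2) = t v

/-- Every parity prescription with sum `|S| - 1` (modulo two) is realizable on `S`. -/
def AlwaysRealizable {W : Type*} (G : SimpleGraph W) (S : Finset W) : Prop :=
  ∀ t : W → ZMod 2, ∑ v ∈ S, t v = S.card + 1 → Realizable G S t

section Realizable

open Classical

variable {W : Type*} {G : SimpleGraph W} {S : Finset W} {t : W → ZMod 2} {v : W}

theorem AlwaysRealizable.singleton (v : W) : AlwaysRealizable G {v} := by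
  intro t ht
  refine ⟨fun _ => 0, by simp, ?_⟩
  intro u hu
  rw [Finset.mem_singleton] at hu
  subst hu
  simp only [Finset.sum_singleton, Finset.card_singleton, Nat.cast_one] at ht
  rw [ht]
  simp [CharTwo.add_self_eq_zero]

theorem ZMod.two_eq_zero_or_one (a : ZMod 2) : a = 0 ∨ a = 1 := by
  revert a
  decide

theorem sum_add_indicator_adj (G : SimpleGraph W) (S : Finset W) (t : W → ZMod 2) (v : W) :
    ∑ u ∈ S, (t u + if G.Adj v u then 1 else 0) =
      ∑ u ∈ S, t u + ((S.filter fun u => G.Adj u v).card : ZMod 2) := by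
  simp [Finset.sum_add_distrib, Finset.sum_boole, G.adj_comm v]

variable [DecidableEq W]

/-- A ranking of `S` extends to `insert v S` with any prescribed value at `v`. -/
theorem exists_rank_extension (r : W → ℤ) (hv : v ∉ S) (hinj : Set.InjOn r S) (m : ℤ)
    (hm : ∀ u ∈ S, r u ≠ m) :
    ∃ r' : W → ℤ, r' v = m ∧ (∀ u ∈ S, r' u = r u) ∧ Set.InjOn r' (insert v S : Finset W) := by
  have hS : ∀ u ∈ S, Function.update r v m u = r u := fun u hu =>
    Function.update_of_ne (ne_of_mem_of_not_mem hu hv) _ _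
  refine ⟨Function.update r v m, by simp, hS, ?_⟩
  rw [Finset.coe_insert, Set.injOn_insert (by simpa using hv)]
  refine ⟨fun a ha b hb hab => hinj ha hb ?_, ?_⟩
  · rwa [hS a ha, hS b hb] at hab
  · rintro ⟨u, hu, huv⟩
    rw [hS u hu, Function.update_self] at huv
    exact hm u hu huv

theorem Realizable.insert_sink (h : Realizable G S t) (hv : v ∉ S)
    (ht : ((S.filter fun u => G.Adj u v).card : ZMod 2) = t v) :
    Realizable G (insert v S) t := by
  obtain ⟨r, hinj, hr⟩ := h
  obtain ⟨M, hM⟩ := (S.image r).bddAbove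
  have hlt : ∀ u ∈ S, r u < M + 1 := fun u hu =>
    Int.lt_add_one_of_le (hM (by simpa using ⟨u, hu, rfl⟩))
  obtain ⟨r', hr'v, hr'S, hr'inj⟩ :=
    exists_rank_extension r hv hinj (M + 1) fun u hu => (hlt u hu).ne
  clear hM hinj
  refine ⟨r', hr'inj, fun u hu => ?_⟩
  rcases Finset.mem_insert.1 hu with rfl | huS
  · rw [← ht]
    congr 2
    ext w
    simp only [Finset.mem_filter, Finset.mem_insert]
    constructor
    · rintro ⟨rfl | hw, hadj, -⟩
      · exact absurd hadj (G.irrefl)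
      · exact ⟨hw, hadj⟩
    · rintro ⟨hw, hadj⟩
      exact ⟨Or.inr hw, hadj, by rw [hr'v, hr'S w hw]; exact hlt w hw⟩
  · rw [← hr u huS]
    congr 2
    ext w
    simp only [Finset.mem_filter, Finset.mem_insert]
    constructor
    · rintro ⟨rfl | hw, hadj, hlt'⟩
      · rw [hr'v, hr'S u huS] at hlt'
        exact absurd hlt' (hlt u huS).not_gt
      · exact ⟨hw, hadj, by rwa [hr'S w hw, hr'S u huS] at hlt'⟩
    · rintro ⟨hw, hadj, hlt'⟩
      exact ⟨Or.inr hw, hadj, by rwa [hr'S w hw, hr'S u huS]⟩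

theorem Realizable.insert_source
    (h : Realizable G S fun u => t u + if G.Adj v u then 1 else 0) (hv : v ∉ S)
    (ht : t v = 0) : Realizable G (insert v S) t := by
  obtain ⟨r, hinj, hr⟩ := h
  obtain ⟨M, hM⟩ := (S.image r).bddBelow
  have hlt : ∀ u ∈ S, M - 1 < r u := fun u hu =>
    Int.sub_one_lt_of_le (hM (by simpa using ⟨u, hu, rfl⟩))
  obtain ⟨r', hr'v, hr'S, hr'inj⟩ :=
    exists_rank_extension r hv hinj (M - 1) fun u hu => (hlt u hu).ne'
  refine ⟨r', hr'inj, fun u hu => ?_⟩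
  rcases Finset.mem_insert.1 hu with rfl | huS
  · rw [ht, Finset.filter_false_of_mem]
    · simp
    · rintro w hw ⟨hadj, hlt'⟩
      rcases Finset.mem_insert.1 hw with rfl | hw
      · exact lt_irrefl _ hlt'
      · rw [hr'v, hr'S w hw] at hlt'
        exact hlt'.not_gt (hlt w hw)
  · have key : (S.filter fun w => G.Adj w u ∧ r' w < r' u) =
        S.filter fun w => G.Adj w u ∧ r w < r u :=
      Finset.filter_congr fun w hw => by rw [hr'S w hw, hr'S u huS]
    have hsum : ((S.filter fun w => G.Adj w u ∧ r w < r u).card : ZMod 2) =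
        t u + if G.Adj v u then 1 else 0 := hr u huS
    have hvu : r' v < r' u := by
      rw [hr'v, hr'S u huS]
      exact hlt u huS
    rw [Finset.filter_insert]
    split_ifs with hif
    · rw [Finset.card_insert_of_notMem (by simp [hv]), key, Nat.cast_add, hsum, if_pos hif.1,
        Nat.cast_one, add_assoc, CharTwo.add_self_eq_zero (1 : ZMod 2), add_zero]
    · rw [key, hsum, if_neg fun hadj => hif ⟨hadj, hvu⟩, add_zero]

/-- A vertex with an odd number of neighbours is always a source or a sink. -/
theorem realizable_insert_of_odd (hv : v ∉ S) (hodd : Odd (S.filter fun u => G.Adj u v).card)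
    (h0 : t v = 0 → Realizable G S fun u => t u + if G.Adj v u then 1 else 0)
    (h1 : t v = 1 → Realizable G S t) : Realizable G (insert v S) t := by
  rcases ZMod.two_eq_zero_or_one (t v) with h | h
  · exact (h0 h).insert_source hv h
  · refine (h1 h).insert_sink hv ?_
    rw [h, ZMod.natCast_eq_one_iff_odd]
    exact hodd

theorem AlwaysRealizable.insert_odd (h : AlwaysRealizable G S) (hv : v ∉ S)
    (hodd : Odd (S.filter fun u => G.Adj u v).card) : AlwaysRealizable G (insert v S) := by
  intro t ht
  rw [Finset.sum_insert hv, Finset.card_insert_of_notMem hv] at ht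
  push_cast at ht
  refine realizable_insert_of_odd hv hodd (fun h0 => h _ ?_) fun h1 => h _ ?_
  · rw [sum_add_indicator_adj, ZMod.natCast_eq_one_iff_odd.2 hodd]
    rw [h0, zero_add] at ht
    rw [ht, add_assoc, CharTwo.add_self_eq_zero (1 : ZMod 2), add_zero]
  · rw [h1] at ht
    linear_combination ht

theorem AlwaysRealizable.realizable_insert_even (h : AlwaysRealizable G S) (hv : v ∉ S)
    (heven : Even (S.filter fun u => G.Adj u v).card) (ht : t v = 0)
    (hsum : ∑ u ∈ insert v S, t u = S.card + 1) : Realizable G (insert v S) t := by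
  rw [Finset.sum_insert hv, ht, zero_add] at hsum
  refine (h t hsum).insert_sink hv ?_
  rw [ht, ZMod.natCast_eq_zero_iff_even]
  exact heven

theorem AlwaysRealizable.realizable_insert_pair {w : W} (h : AlwaysRealizable G S) (hw : w ∉ S)
    (hv : v ∉ insert w S) (hadj : G.Adj v w) (heven : Even (S.filter fun u => G.Adj u w).card)
    (hodd : Odd ((insert w S).filter fun u => G.Adj u v).card) (hvw : t v ≠ t w)
    (hsum : ∑ u ∈ insert v (insert w S), t u = S.card) :
    Realizable G (insert v (insert w S)) t := by
  rw [Finset.sum_insert hv] at hsum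
  refine realizable_insert_of_odd hv hodd
    (fun h0 => h.realizable_insert_even hw heven ?_ ?_)
    fun h1 => h.realizable_insert_even hw heven ?_ ?_
  · rcases ZMod.two_eq_zero_or_one (t w) with h | h
    · exact absurd (h0.trans h.symm) hvw
    · rw [h, if_pos hadj, CharTwo.add_self_eq_zero (1 : ZMod 2)]
  · rw [sum_add_indicator_adj, ZMod.natCast_eq_one_iff_odd.2 hodd]
    rw [h0, zero_add] at hsum
    rw [hsum]
  · rcases ZMod.two_eq_zero_or_one (t w) with h | h
    · exact h
    · exact absurd (h1.trans h.symm) hvw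
  · rw [h1] at hsum
    have h2 := CharTwo.add_self_eq_zero (1 : ZMod 2)
    linear_combination hsum - h2

/-- Deleting a vertex of even degree which can be both a source and a sink. -/
theorem AlwaysRealizable.realizable_of_erase (hv : v ∈ S) (h : AlwaysRealizable G (S.erase v))
    (heven : Even (S.filter fun u => G.Adj u v).card) (ht : t v = 0)
    (hsum : ∑ u ∈ S, t u = S.card) : Realizable G S t := by
  have hfilter : ((S.erase v).filter fun u => G.Adj u v) = S.filter fun u => G.Adj u v := by
    ext u
    simp only [Finset.mem_filter, Finset.mem_erase]
    exact ⟨fun h => ⟨h.1.2, h.2⟩, fun h => ⟨⟨h.2.ne, h.1⟩, h.2⟩⟩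
  rw [← Finset.insert_erase hv]
  refine h.realizable_insert_even (Finset.notMem_erase v S) (by rwa [hfilter]) ht ?_
  rw [Finset.insert_erase hv, hsum, ← Finset.card_erase_add_one hv]
  push_cast
  rfl

/-- Deleting two adjacent vertices of odd degree, exactly one of which belongs to `T`. -/
theorem AlwaysRealizable.realizable_of_erase_pair {w : W} (hv : v ∈ S) (hw : w ∈ S)
    (h : AlwaysRealizable G ((S.erase v).erase w)) (hadj : G.Adj v w)
    (hoddv : Odd (S.filter fun u => G.Adj u v).card)
    (hoddw : Odd (S.filter fun u => G.Adj u w).card) (hvw : t v ≠ t w)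
    (hsum : ∑ u ∈ S, t u = S.card) : Realizable G S t := by
  have hw' : w ∈ S.erase v := Finset.mem_erase.2 ⟨hadj.ne', hw⟩
  have hfilterv : ((S.erase v).filter fun u => G.Adj u v) = S.filter fun u => G.Adj u v := by
    ext u
    simp only [Finset.mem_filter, Finset.mem_erase]
    exact ⟨fun h => ⟨h.1.2, h.2⟩, fun h => ⟨⟨h.2.ne, h.1⟩, h.2⟩⟩
  have hfilterw : (((S.erase v).erase w).filter fun u => G.Adj u w) =
      (S.filter fun u => G.Adj u w).erase v := by
    ext u
    simp only [Finset.mem_filter, Finset.mem_erase]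
    exact ⟨fun h => ⟨h.1.2.1, h.1.2.2, h.2⟩, fun h => ⟨⟨h.2.2.ne, h.1, h.2.1⟩, h.2.2⟩⟩
  have hcard := Finset.card_erase_add_one (show v ∈ S.filter fun u => G.Adj u w by simp [hv, hadj])
  rw [← Finset.insert_erase hv, ← Finset.insert_erase hw']
  refine h.realizable_insert_pair (Finset.notMem_erase w _) ?_ hadj ?_ ?_ hvw ?_
  · rw [Finset.insert_erase hw']
    exact Finset.notMem_erase v S
  · rw [hfilterw, ← Nat.not_odd_iff_even]
    intro hodd
    rw [← hcard] at hoddw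
    exact Nat.not_even_iff_odd.2 hoddw hodd.add_one
  · rwa [Finset.insert_erase hw', hfilterv]
  · rw [Finset.insert_erase hw', Finset.insert_erase hv, hsum, ← Finset.card_erase_add_one hv,
      ← Finset.card_erase_add_one hw']
    push_cast
    rw [add_assoc, CharTwo.add_self_eq_zero (1 : ZMod 2), add_zero]

theorem AlwaysRealizable.insert_one (h : AlwaysRealizable G S) (hv : v ∉ S) (u : W) (hu : u ∈ S)
    (hadj : ∀ w ∈ S, G.Adj w v ↔ w = u) : AlwaysRealizable G (insert v S) := by
  refine h.insert_odd hv ?_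
  have : (S.filter fun w => G.Adj w v) = {u} := by
    ext w
    grind
  simp [this]

theorem AlwaysRealizable.insert_three (h : AlwaysRealizable G S) (hv : v ∉ S) {a b c : W}
    (ha : a ∈ S) (hb : b ∈ S) (hc : c ∈ S) (hab : a ≠ b) (hac : a ≠ c) (hbc : b ≠ c)
    (hadj : ∀ w ∈ S, G.Adj w v ↔ w = a ∨ w = b ∨ w = c) : AlwaysRealizable G (insert v S) := by
  refine h.insert_odd hv ?_
  have : (S.filter fun w => G.Adj w v) = {a, b, c} := by
    ext w
    grind
  rw [this, Finset.card_eq_three.2 ⟨a, b, c, hab, hac, hbc, rfl⟩]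
  decide

end Realizable

section Orientation

open Classical

variable {V : Type*}

theorem GraphOrientation.sum_indeg [Fintype V] {G : SimpleGraph V} (o : GraphOrientation G) :
    ∑ v, o.indeg v = G.edgeSet.ncard := by
  have hasymm : ∀ {u v}, o.dir u v → ¬ o.dir v u := fun {u v} h =>
    (o.dir_choice u v (o.dir_adj u v h)).1 h
  have himage : (fun q : V × V => s(q.1, q.2)) '' {q | o.dir q.1 q.2} = G.edgeSet := by
    ext e
    induction e with
    | h u v =>
      simp only [Set.mem_image, Set.mem_ofPred_eq, Prod.exists, Sym2.eq_iff,
        SimpleGraph.mem_edgeSet]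
      constructor
      · rintro ⟨a, b, hab, ⟨rfl, rfl⟩ | ⟨rfl, rfl⟩⟩
        · exact o.dir_adj _ _ hab
        · exact (o.dir_adj _ _ hab).symm
      · intro h
        by_cases huv : o.dir u v
        · exact ⟨u, v, huv, Or.inl ⟨rfl, rfl⟩⟩
        · exact ⟨v, u, (o.dir_choice v u h.symm).2 huv, Or.inr ⟨rfl, rfl⟩⟩
  rw [← himage, Set.InjOn.ncard_image, Set.ncard_eq_toFinset_card',
    Finset.card_eq_sum_card_fiberwise (f := Prod.snd) (t := Finset.univ) (by simp)]
  · refine Finset.sum_congr rfl fun v _ => ?_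
    rw [GraphOrientation.indeg, Set.ncard_eq_toFinset_card']
    refine Finset.card_nbij (fun u => (u, v)) ?_ ?_ ?_
    · intro u hu
      simpa using hu
    · intro a _ b _ hab
      exact (Prod.ext_iff.1 hab).1
    · rintro ⟨a, b⟩ hab
      simp only [Finset.coe_filter, Set.mem_toFinset, Set.mem_ofPred_eq] at hab
      obtain ⟨hab, rfl⟩ := hab
      exact ⟨a, by simpa using hab, rfl⟩
  · rintro ⟨a, b⟩ hab ⟨c, d⟩ hcd h
    rcases Sym2.eq_iff.1 h with ⟨h1, h2⟩ | ⟨h1, h2⟩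
    · exact Prod.ext h1 h2
    · dsimp only at h1 h2
      subst h1 h2
      exact absurd hcd (hasymm hab)

theorem natCast_ncard_eq_sum [Fintype V] {T : Set V} {t : V → ZMod 2} (ht : ∀ v, t v = 1 ↔ v ∈ T) :
    (T.ncard : ZMod 2) = ∑ v, t v := by
  have : ∀ v, t v = if v ∈ T then 1 else 0 := by
    intro v
    split_ifs with h
    · exact (ht v).2 h
    · exact (ZMod.two_eq_zero_or_one _).resolve_right fun h1 => h ((ht v).1 h1)
  rw [Finset.sum_congr rfl fun v _ => this v, Finset.sum_boole, Set.ncard_eq_toFinset_card']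
  congr 2
  ext
  simp

theorem condP_iff {G : SimpleGraph V} {T : Set V} :
    CondP G T ↔ (T.ncard : ZMod 2) = G.edgeSet.ncard := by
  rw [CondP, ← ZMod.natCast_eq_zero_iff_even, Nat.cast_add, CharTwo.add_eq_zero, eq_comm]

theorem HasAcyclicTOddOrientation.condP [Fintype V] {G : SimpleGraph V} {T : Set V}
    (h : HasAcyclicTOddOrientation G T) : CondP G T := by
  obtain ⟨o, -, ho⟩ := h
  rw [condP_iff, ← o.sum_indeg, Nat.cast_sum]
  exact natCast_ncard_eq_sum fun v => ZMod.natCast_eq_one_iff_odd.trans (ho v)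

theorem Realizable.hasAcyclicTOddOrientation [Fintype V] {W : Type*} {G : SimpleGraph W}
    {H : SimpleGraph V} (f : V ↪ W) (hf : ∀ u v, H.Adj u v ↔ G.Adj (f u) (f v))
    {T : Set V} {t : W → ZMod 2}
    (ht : ∀ v, t (f v) = 1 ↔ v ∈ T) (h : Realizable G (Finset.univ.map f) t) :
    HasAcyclicTOddOrientation H T := by
  obtain ⟨r, hinj, hr⟩ := h
  refine ⟨⟨fun u v => H.Adj u v ∧ r (f u) < r (f v), fun u v h => h.1, ?_⟩, ?_, ?_⟩
  · intro u v huv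
    have hne : r (f u) ≠ r (f v) := fun h =>
      huv.ne (f.injective (hinj (by simp) (by simp) h))
    have := huv.symm
    constructor
    · rintro ⟨-, h⟩ ⟨-, h'⟩
      exact h.not_gt h'
    · intro h
      exact ⟨huv, hne.lt_of_le (not_lt.1 fun h' => h ⟨this, h'⟩)⟩
  · intro v hv
    have hlt : ∀ {a b}, Relation.TransGen (fun u v => H.Adj u v ∧ r (f u) < r (f v)) a b →
        r (f a) < r (f b) := by
      intro a b hab
      induction hab with
      | single h => exact h.2
      | tail _ h ih => exact ih.trans h.2
    exact lt_irrefl _ (hlt hv)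
  · intro v
    rw [← ht v, ← hr (f v) (by simp), ZMod.natCast_eq_one_iff_odd, GraphOrientation.indeg,
      Set.ncard_eq_toFinset_card', Finset.filter_map, Finset.card_map]
    refine iff_of_eq (congrArg _ (congrArg _ ?_))
    ext u
    simp [hf]

end Orientation

/-- The ladder on the columns `1, 2, …`, whose row `0` is closed up by the path through
`(n, 0)`, `(0, 0)`, `(1, 0)`. -/
def closedLadder (n : ℕ) : SimpleGraph (ℕ × ℕ) where
  Adj u v := (u.2 = v.2 ∧ (u.1 + 1 = v.1 ∨ v.1 + 1 = u.1)) ∨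
    (u.1 = v.1 ∧ (u.2 + 1 = v.2 ∨ v.2 + 1 = u.2)) ∨
    (0 < n ∧ u.2 = 0 ∧ v.2 = 0 ∧ ((u.1 = 0 ∧ v.1 = n) ∨ (u.1 = n ∧ v.1 = 0)))
  symm := ⟨fun u v h => by omega⟩
  loopless := ⟨fun u h => by omega⟩

/-- The vertices of the quasi 2-cylinder with `n` rungs. -/
def quasiCylinderVertices (n : ℕ) : Finset (ℕ × ℕ) :=
  (Finset.range (n + 1) ×ˢ Finset.range 2).erase (0, 1)

theorem closedLadder_adj {n i l j m : ℕ} : (closedLadder n).Adj (i, l) (j, m) ↔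
    (l = m ∧ (i + 1 = j ∨ j + 1 = i)) ∨ (i = j ∧ (l + 1 = m ∨ m + 1 = l)) ∨
    (0 < n ∧ l = 0 ∧ m = 0 ∧ ((i = 0 ∧ j = n) ∨ (i = n ∧ j = 0))) :=
  Iff.rfl

theorem mem_quasiCylinderVertices {n i l : ℕ} :
    (i, l) ∈ quasiCylinderVertices n ↔ i ≤ n ∧ l < 2 ∧ (i = 0 → l = 0) := by
  simp only [quasiCylinderVertices, Finset.mem_erase, Finset.mem_product, Finset.mem_range, ne_eq,
    Prod.mk.injEq]
  omega

/-- The coordinates satisfying `P` are those of a finite set of vertices of the ladder on which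
every parity prescription of the right sum is realizable. -/
def LadderRealizable (n : ℕ) (P : ℕ → ℕ → Prop) : Prop :=
  ∃ S : Finset (ℕ × ℕ), (∀ a b, (a, b) ∈ S ↔ P a b) ∧ AlwaysRealizable (closedLadder n) S

section Ladder

variable {n : ℕ} {P : ℕ → ℕ → Prop}

theorem LadderRealizable.alwaysRealizable (h : LadderRealizable n P) {S : Finset (ℕ × ℕ)}
    (hS : ∀ a b, (a, b) ∈ S ↔ P a b) : AlwaysRealizable (closedLadder n) S := by
  obtain ⟨S', hS', h⟩ := h
  have : S = S' := by
    ext ⟨a, b⟩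
    rw [hS, hS']
  rwa [this]

theorem LadderRealizable.congr (h : LadderRealizable n P) {Q : ℕ → ℕ → Prop}
    (hPQ : ∀ a b, Q a b ↔ P a b) : LadderRealizable n Q := by
  obtain ⟨S, hS, h⟩ := h
  exact ⟨S, fun a b => (hS a b).trans (hPQ a b).symm, h⟩

theorem ladderRealizable_singleton (i l : ℕ) :
    LadderRealizable n fun a b => a = i ∧ b = l :=
  ⟨{(i, l)}, by simp, AlwaysRealizable.singleton _⟩

/-- Adding a vertex `(i, l)` whose only neighbour is `(j, m)`. -/
theorem LadderRealizable.leaf (h : LadderRealizable n P) (i l j m : ℕ) (hu : P j m)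
    (hP : ∀ a b, P a b → ¬(a = i ∧ b = l) ∧
      (((b = l ∧ (a + 1 = i ∨ i + 1 = a)) ∨ (a = i ∧ (b + 1 = l ∨ l + 1 = b)) ∨
        (0 < n ∧ b = 0 ∧ l = 0 ∧ ((a = 0 ∧ i = n) ∨ (a = n ∧ i = 0)))) ↔ a = j ∧ b = m)) :
    LadderRealizable n fun a b => (a = i ∧ b = l) ∨ P a b := by
  obtain ⟨S, hS, h⟩ := h
  refine ⟨insert (i, l) S, fun a b => by rw [Finset.mem_insert, hS, Prod.mk.injEq],
    h.insert_one (fun hmem => (hP i l ((hS i l).1 hmem)).1 ⟨rfl, rfl⟩) (j, m) ((hS j m).2 hu) ?_⟩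
  rintro ⟨a, b⟩ hw
  rw [closedLadder_adj, (hP a b ((hS a b).1 hw)).2, Prod.mk.injEq]

/-- Adding a vertex `(i, l)` with exactly three neighbours. -/
theorem LadderRealizable.junction (h : LadderRealizable n P) (i l : ℕ) {a₁ b₁ a₂ b₂ a₃ b₃ : ℕ}
    (h₁ : P a₁ b₁) (h₂ : P a₂ b₂) (h₃ : P a₃ b₃) (h₁₂ : ¬(a₁ = a₂ ∧ b₁ = b₂))
    (h₁₃ : ¬(a₁ = a₃ ∧ b₁ = b₃)) (h₂₃ : ¬(a₂ = a₃ ∧ b₂ = b₃))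
    (hP : ∀ a b, P a b → ¬(a = i ∧ b = l) ∧
      (((b = l ∧ (a + 1 = i ∨ i + 1 = a)) ∨ (a = i ∧ (b + 1 = l ∨ l + 1 = b)) ∨
        (0 < n ∧ b = 0 ∧ l = 0 ∧ ((a = 0 ∧ i = n) ∨ (a = n ∧ i = 0)))) ↔
        a = a₁ ∧ b = b₁ ∨ a = a₂ ∧ b = b₂ ∨ a = a₃ ∧ b = b₃)) :
    LadderRealizable n fun a b => (a = i ∧ b = l) ∨ P a b := by
  obtain ⟨S, hS, h⟩ := h
  refine ⟨insert (i, l) S, fun a b => by rw [Finset.mem_insert, hS, Prod.mk.injEq],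
    h.insert_three (fun hmem => (hP i l ((hS i l).1 hmem)).1 ⟨rfl, rfl⟩) ((hS _ _).2 h₁)
      ((hS _ _).2 h₂) ((hS _ _).2 h₃) (by simpa using h₁₂) (by simpa using h₁₃)
      (by simpa using h₂₃) ?_⟩
  rintro ⟨a, b⟩ hw
  rw [closedLadder_adj, (hP a b ((hS a b).1 hw)).2, Prod.mk.injEq, Prod.mk.injEq, Prod.mk.injEq]

/-- Adding the columns `m + 1, …, m + 2 * k`. -/
theorem LadderRealizable.extend_right {m : ℕ} (h : LadderRealizable n P)
    (hm : 1 ≤ m) (h0 : P m 0) (h1 : P m 1) (k : ℕ) (hk : m + 2 * k ≤ n)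
    (hP : ∀ a b, P a b → b < 2 ∧ (a ≤ m ∨ m + 2 * k + 1 < a) ∧
      (m + 2 * k = n → a = 0 → b ≠ 0)) :
    LadderRealizable n fun a b => P a b ∨ (m + 1 ≤ a ∧ a ≤ m + 2 * k ∧ b < 2) := by
  induction k with
  | zero => exact h.congr fun a b => or_iff_left (by omega)
  | succ k ih =>
    have hsq := ih (by omega) fun a b hab => by
      have := hP a b hab
      omega
    have hmem : ∀ a b, P a b ∨ (m + 1 ≤ a ∧ a ≤ m + 2 * k ∧ b < 2) →
        b < 2 ∧ (a ≤ m + 2 * k ∨ m + 2 * k + 3 < a) ∧ (m + 2 * k + 2 = n → a = 0 → b ≠ 0) := by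
      rintro a b (hab | hab)
      · have := hP a b hab
        omega
      · omega
    have hlast : ∀ b, b < 2 →
        P (m + 2 * k) b ∨ (m + 1 ≤ m + 2 * k ∧ m + 2 * k ≤ m + 2 * k ∧ b < 2) := by
      intro b hb
      rcases Nat.eq_zero_or_pos k with rfl | hk0
      · interval_cases b <;> simp [h0, h1]
      · omega
    have s1 := hsq.leaf (m + 2 * k + 1) 1 (m + 2 * k) 1 (hlast 1 (by omega)) (by
      intro a b hab
      have := hmem a b hab
      omega)
    have s2 := s1.leaf (m + 2 * k + 2) 1 (m + 2 * k + 1) 1 (Or.inl (by omega)) (by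
      intro a b hab
      have := hab.imp_right (hmem a b)
      omega)
    have s3 := s2.leaf (m + 2 * k + 2) 0 (m + 2 * k + 2) 1 (Or.inl (by omega)) (by
      intro a b hab
      have := hab.imp_right (Or.imp_right (hmem a b))
      omega)
    have s4 := s3.junction (m + 2 * k + 1) 0 (a₁ := m + 2 * k) (b₁ := 0) (a₂ := m + 2 * k + 2)
      (b₂ := 0) (a₃ := m + 2 * k + 1) (b₃ := 1)
      (Or.inr (Or.inr (Or.inr (hlast 0 (by omega))))) (Or.inl (by omega))
      (Or.inr (Or.inr (Or.inl (by omega)))) (by omega) (by omega) (by omega) (by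
      intro a b hab
      have := hab.imp_right (Or.imp_right (Or.imp_right (hmem a b)))
      omega)
    refine s4.congr fun a b => ?_
    by_cases hab : P a b
    · simp [hab]
    · simp only [hab, false_or]
      omega

/-- Adding the columns `c, …, c + 2 * k - 1`. -/
theorem LadderRealizable.extend_left {c k : ℕ} (h : LadderRealizable n P)
    (hc : 1 ≤ c) (hk : c + 2 * k ≤ n) (h0 : P (c + 2 * k) 0) (h1 : P (c + 2 * k) 1)
    (hP : ∀ a b, P a b → b < 2 ∧ (a + 1 < c ∨ c + 2 * k ≤ a)) :
    LadderRealizable n fun a b => P a b ∨ (c ≤ a ∧ a < c + 2 * k ∧ b < 2) := by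
  induction k generalizing c with
  | zero => exact h.congr fun a b => or_iff_left (by omega)
  | succ k ih =>
    have hck : c + 2 + 2 * k = c + 2 * (k + 1) := by ring
    have hsq := ih (c := c + 2) (by omega) (by omega) (by rwa [hck]) (by rwa [hck])
      fun a b hab => by
        have := hP a b hab
        omega
    have hmem : ∀ a b, P a b ∨ (c + 2 ≤ a ∧ a < c + 2 + 2 * k ∧ b < 2) →
        b < 2 ∧ (a + 1 < c ∨ c + 2 ≤ a) := by
      rintro a b (hab | hab)
      · have := hP a b hab
        omega
      · omega
    have hlast : ∀ b, b < 2 →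
        P (c + 2) b ∨ (c + 2 ≤ c + 2 ∧ c + 2 < c + 2 + 2 * k ∧ b < 2) := by
      intro b hb
      rcases Nat.eq_zero_or_pos k with rfl | hk0
      · refine Or.inl ?_
        interval_cases b <;> assumption
      · omega
    have s1 := hsq.leaf (c + 1) 1 (c + 2) 1 (hlast 1 (by omega)) (by
      intro a b hab
      have := hmem a b hab
      omega)
    have s2 := s1.leaf c 1 (c + 1) 1 (Or.inl (by omega)) (by
      intro a b hab
      have := hab.imp_right (hmem a b)
      omega)
    have s3 := s2.leaf c 0 c 1 (Or.inl (by omega)) (by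
      intro a b hab
      have := hab.imp_right (Or.imp_right (hmem a b))
      omega)
    have s4 := s3.junction (c + 1) 0 (a₁ := c + 2) (b₁ := 0) (a₂ := c) (b₂ := 0) (a₃ := c + 1)
      (b₃ := 1) (Or.inr (Or.inr (Or.inr (hlast 0 (by omega))))) (Or.inl (by omega))
      (Or.inr (Or.inr (Or.inl (by omega)))) (by omega) (by omega) (by omega) (by
      intro a b hab
      have := hab.imp_right (Or.imp_right (Or.imp_right (hmem a b)))
      omega)
    refine s4.congr fun a b => ?_
    by_cases hab : P a b
    · simp [hab]
    · simp only [hab, false_or]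
      omega

/-- Any odd number of consecutive columns. -/
theorem ladderRealizable_columns {c k : ℕ} (hc : 1 ≤ c) (hk : c + 2 * k ≤ n) :
    LadderRealizable n fun a b => c ≤ a ∧ a ≤ c + 2 * k ∧ b < 2 := by
  have s1 := (ladderRealizable_singleton (n := n) c 0).leaf c 1 c 0 (by omega) (by omega)
  have s2 := s1.extend_right hc (by omega) (by omega) k hk (by omega)
  exact s2.congr (by omega)

theorem alwaysRealizable_quasiCylinderVertices (hn : 2 ≤ n) (heven : Even n) :
    AlwaysRealizable (closedLadder n) (quasiCylinderVertices n) := by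
  obtain ⟨k, rfl⟩ : ∃ k, n = 2 * k + 2 := by
    obtain ⟨k, rfl⟩ := heven
    exact ⟨k - 1, by omega⟩
  have s1 := (ladderRealizable_columns (n := 2 * k + 2) (c := 1) (k := k) le_rfl
    (by omega)).leaf (2 * k + 2) 1 (2 * k + 1) 1 (by omega) (by omega)
  have s2 := s1.leaf 0 0 1 0 (by omega) (by omega)
  have s3 := s2.junction (2 * k + 2) 0 (a₁ := 0) (b₁ := 0) (a₂ := 2 * k + 1) (b₂ := 0)
    (a₃ := 2 * k + 2) (b₃ := 1) (by omega) (by omega) (by omega) (by omega) (by omega) (by omega)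
    (by omega)
  refine s3.alwaysRealizable fun a b => ?_
  simp only [mem_quasiCylinderVertices]
  omega

theorem alwaysRealizable_erase_hub (hodd : Odd n) :
    AlwaysRealizable (closedLadder n) ((quasiCylinderVertices n).erase (0, 0)) := by
  obtain ⟨k, rfl⟩ := hodd
  refine (ladderRealizable_columns (n := 2 * k + 1) (c := 1) (k := k) le_rfl
    (by omega)).alwaysRealizable fun a b => ?_
  simp only [mem_quasiCylinderVertices, Finset.mem_erase, ne_eq, Prod.mk.injEq]
  omega

theorem alwaysRealizable_erase_last_corner (hn : 3 ≤ n) (hodd : Odd n) :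
    AlwaysRealizable (closedLadder n) ((quasiCylinderVertices n).erase (n, 1)) := by
  obtain ⟨k, rfl⟩ : ∃ k, n = 2 * k + 3 := by
    obtain ⟨k, rfl⟩ := hodd
    exact ⟨k - 1, by omega⟩
  have s1 := (ladderRealizable_columns (n := 2 * k + 3) (c := 2) (k := k) (by omega)
    (by omega)).leaf 1 1 2 1 (by omega) (by omega)
  have s2 := s1.leaf (2 * k + 3) 0 (2 * k + 2) 0 (by omega) (by omega)
  have s3 := s2.leaf 0 0 (2 * k + 3) 0 (by omega) (by omega)
  have s4 := s3.junction 1 0 (a₁ := 0) (b₁ := 0) (a₂ := 2) (b₂ := 0) (a₃ := 1) (b₃ := 1)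
    (by omega) (by omega) (by omega) (by omega) (by omega) (by omega) (by omega)
  refine s4.alwaysRealizable fun a b => ?_
  simp only [mem_quasiCylinderVertices, Finset.mem_erase, ne_eq, Prod.mk.injEq]
  omega

theorem alwaysRealizable_erase_first_corner (hn : 3 ≤ n) (hodd : Odd n) :
    AlwaysRealizable (closedLadder n) ((quasiCylinderVertices n).erase (1, 1)) := by
  obtain ⟨k, rfl⟩ : ∃ k, n = 2 * k + 3 := by
    obtain ⟨k, rfl⟩ := hodd
    exact ⟨k - 1, by omega⟩
  have s1 := (ladderRealizable_columns (n := 2 * k + 3) (c := 2) (k := k) (by omega)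
    (by omega)).leaf (2 * k + 3) 1 (2 * k + 2) 1 (by omega) (by omega)
  have s2 := s1.leaf 1 0 2 0 (by omega) (by omega)
  have s3 := s2.leaf 0 0 1 0 (by omega) (by omega)
  have s4 := s3.junction (2 * k + 3) 0 (a₁ := 0) (b₁ := 0) (a₂ := 2 * k + 2) (b₂ := 0)
    (a₃ := 2 * k + 3) (b₃ := 1) (by omega) (by omega) (by omega) (by omega) (by omega) (by omega)
    (by omega)
  refine s4.alwaysRealizable fun a b => ?_
  simp only [mem_quasiCylinderVertices, Finset.mem_erase, ne_eq, Prod.mk.injEq]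
  omega

/-- Deleting the two ends of a rung in an even column. -/
theorem alwaysRealizable_erase_rung {i : ℕ} (hi : 2 ≤ i) (hin : i < n) (heven : Even i)
    (hodd : Odd n) :
    AlwaysRealizable (closedLadder n) (((quasiCylinderVertices n).erase (i, 0)).erase (i, 1)) := by
  obtain ⟨j, rfl⟩ : ∃ j, i = 2 * j + 2 := by
    obtain ⟨j, rfl⟩ := heven
    exact ⟨j - 1, by omega⟩
  obtain ⟨k, rfl⟩ : ∃ k, n = 2 * j + 3 + 2 * k := by
    obtain ⟨k, rfl⟩ := hodd
    exact ⟨k - j - 1, by omega⟩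
  have s1 := (ladderRealizable_columns (n := 2 * j + 3 + 2 * k) (c := 1) (k := j) le_rfl
    (by omega)).leaf 0 0 1 0 (by omega) (by omega)
  have s2 := s1.leaf (2 * j + 3 + 2 * k) 0 0 0 (by omega) (by omega)
  have s3 := s2.leaf (2 * j + 3 + 2 * k) 1 (2 * j + 3 + 2 * k) 0 (by omega) (by omega)
  have s4 := s3.extend_left (c := 2 * j + 3) (k := k) (by omega) le_rfl (by omega) (by omega)
    (by omega)
  refine s4.alwaysRealizable fun a b => ?_
  simp only [mem_quasiCylinderVertices, Finset.mem_erase, ne_eq, Prod.mk.injEq]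
  omega

/-- Deleting two consecutive vertices of a row, the first one in an even column. -/
theorem alwaysRealizable_erase_inner_edge {i l : ℕ} (hi : 2 ≤ i) (hin : i + 2 < n)
    (heven : Even i) (hodd : Odd n) (hl : l < 2) :
    AlwaysRealizable (closedLadder n)
      (((quasiCylinderVertices n).erase (i, l)).erase (i + 1, l)) := by
  obtain ⟨j, rfl⟩ : ∃ j, i = 2 * j + 2 := by
    obtain ⟨j, rfl⟩ := heven
    exact ⟨j - 1, by omega⟩
  obtain ⟨k, rfl⟩ : ∃ k, n = 2 * j + 5 + 2 * k := by
    obtain ⟨k, rfl⟩ := hodd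
    exact ⟨k - j - 2, by omega⟩
  have s1 := (ladderRealizable_singleton (n := 2 * j + 5 + 2 * k) (2 * j + 2) (1 - l)).leaf
    (2 * j + 3) (1 - l) (2 * j + 2) (1 - l) (by omega) (by omega)
  have s2 := s1.leaf (2 * j + 1) (1 - l) (2 * j + 2) (1 - l) (by omega) (by omega)
  have s3 := s2.leaf (2 * j + 1) l (2 * j + 1) (1 - l) (by omega) (by omega)
  have s4 := s3.leaf (2 * j + 4) (1 - l) (2 * j + 3) (1 - l) (by omega) (by omega)
  have s5 := s4.leaf (2 * j + 4) l (2 * j + 4) (1 - l) (by omega) (by omega)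
  have s6 := s5.extend_left (c := 1) (k := j) le_rfl (by omega) (by omega) (by omega) (by omega)
  have s7 := s6.extend_right (m := 2 * j + 4) (by omega) (by omega) (by omega) k (by omega)
    (by omega)
  have s8 := s7.leaf (2 * j + 5 + 2 * k) 1 (2 * j + 4 + 2 * k) 1 (by omega) (by omega)
  have s9 := s8.leaf 0 0 1 0 (by omega) (by omega)
  have s10 := s9.junction (2 * j + 5 + 2 * k) 0 (a₁ := 0) (b₁ := 0) (a₂ := 2 * j + 4 + 2 * k)
    (b₂ := 0) (a₃ := 2 * j + 5 + 2 * k) (b₃ := 1) (by omega) (by omega) (by omega) (by omega)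
    (by omega) (by omega) (by omega)
  refine s10.alwaysRealizable fun a b => ?_
  simp only [mem_quasiCylinderVertices, Finset.mem_erase, ne_eq, Prod.mk.injEq]
  omega

/-- Deleting the last two vertices of row `0`. -/
theorem alwaysRealizable_erase_last_edge {i : ℕ} (hi : 2 ≤ i) (heven : Even i) :
    AlwaysRealizable (closedLadder (i + 1))
      (((quasiCylinderVertices (i + 1)).erase (i, 0)).erase (i + 1, 0)) := by
  obtain ⟨k, rfl⟩ : ∃ k, i = 2 * k + 2 := by
    obtain ⟨k, rfl⟩ := heven
    exact ⟨k - 1, by omega⟩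
  have s1 := (ladderRealizable_columns (n := 2 * k + 2 + 1) (c := 1) (k := k) le_rfl
    (by omega)).leaf (2 * k + 2) 1 (2 * k + 1) 1 (by omega) (by omega)
  have s2 := s1.leaf (2 * k + 3) 1 (2 * k + 2) 1 (by omega) (by omega)
  have s3 := s2.leaf 0 0 1 0 (by omega) (by omega)
  refine s3.alwaysRealizable fun a b => ?_
  simp only [mem_quasiCylinderVertices, Finset.mem_erase, ne_eq, Prod.mk.injEq]
  omega

/-- Deleting two consecutive vertices of row `0`, the first one in an odd column. -/
theorem alwaysRealizable_erase_odd_edge {i : ℕ} (hin : i + 2 ≤ n) (hi : Odd i) (hodd : Odd n) :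
    AlwaysRealizable (closedLadder n)
      (((quasiCylinderVertices n).erase (i, 0)).erase (i + 1, 0)) := by
  obtain ⟨k, rfl⟩ : ∃ k, n = i + 2 + 2 * k := by
    obtain ⟨j, rfl⟩ := hi
    obtain ⟨k, rfl⟩ := hodd
    exact ⟨k - j - 1, by omega⟩
  obtain ⟨j, rfl⟩ := hi
  have s1 := (ladderRealizable_columns (n := 2 * j + 1 + 2 + 2 * k) (c := 2 * j + 3) (k := k)
    (by omega) (by omega)).leaf (2 * j + 2) 1 (2 * j + 3) 1 (by omega) (by omega)
  have s2 := s1.leaf (2 * j + 1) 1 (2 * j + 2) 1 (by omega) (by omega)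
  rcases Nat.eq_zero_or_pos j with rfl | hj
  · have s3 := s2.leaf 0 0 (2 * k + 3) 0 (by omega) (by omega)
    refine s3.alwaysRealizable fun a b => ?_
    simp only [mem_quasiCylinderVertices, Finset.mem_erase, ne_eq, Prod.mk.injEq]
    omega
  · obtain ⟨j, rfl⟩ := Nat.exists_eq_add_of_le' hj
    have s3 := s2.leaf (2 * j + 2) 1 (2 * j + 3) 1 (by omega) (by omega)
    have s4 := s3.leaf (2 * j + 2) 0 (2 * j + 2) 1 (by omega) (by omega)
    have s5 := s4.extend_left (c := 2) (k := j) (by omega) (by omega) (by omega) (by omega)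
      (by omega)
    have s6 := s5.leaf 1 1 2 1 (by omega) (by omega)
    have s7 := s6.leaf 0 0 (2 * (j + 1) + 1 + 2 + 2 * k) 0 (by omega) (by omega)
    have s8 := s7.junction 1 0 (a₁ := 0) (b₁ := 0) (a₂ := 2) (b₂ := 0) (a₃ := 1) (b₃ := 1)
      (by omega) (by omega) (by omega) (by omega) (by omega) (by omega) (by omega)
    refine s8.alwaysRealizable fun a b => ?_
    simp only [mem_quasiCylinderVertices, Finset.mem_erase, ne_eq, Prod.mk.injEq]
    omega

theorem card_quasiCylinderVertices : (quasiCylinderVertices n).card = 2 * n + 1 := by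
  rw [quasiCylinderVertices, Finset.card_erase_of_mem (by simp), Finset.card_product,
    Finset.card_range, Finset.card_range]
  omega

theorem natCast_card_quasiCylinderVertices : ((quasiCylinderVertices n).card : ZMod 2) = 1 := by
  rw [ZMod.natCast_eq_one_iff_odd, card_quasiCylinderVertices]
  exact odd_two_mul_add_one n

open Classical in
theorem even_card_neighbors {v : ℕ × ℕ} (hn : 3 ≤ n)
    (h : v = (0, 0) ∨ v = (1, 1) ∨ v = (n, 1)) :
    Even ((quasiCylinderVertices n).filter fun u => (closedLadder n).Adj u v).card := by
  suffices ((quasiCylinderVertices n).filter fun u => (closedLadder n).Adj u v).card = 2 by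
    rw [this]
    exact even_two
  rw [Finset.card_eq_two]
  rcases h with rfl | rfl | rfl
  on_goal 1 => refine ⟨(1, 0), (n, 0), ?_, ?_⟩
  on_goal 3 => refine ⟨(2, 1), (1, 0), ?_, ?_⟩
  on_goal 5 => refine ⟨(n - 1, 1), (n, 0), ?_, ?_⟩
  all_goals
    first
    | ext ⟨a, b⟩
      simp only [Finset.mem_filter, mem_quasiCylinderVertices, closedLadder_adj,
        Finset.mem_insert, Finset.mem_singleton, Prod.mk.injEq, true_and, and_true]
      omega
    | rw [ne_eq, Prod.mk.injEq]
      omega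

open Classical in
theorem odd_card_neighbors {i l : ℕ} (hn : 3 ≤ n) (hv : (i, l) ∈ quasiCylinderVertices n)
    (h0 : i ≠ 0) (h1 : ¬(i = 1 ∧ l = 1)) (h2 : ¬(i = n ∧ l = 1)) :
    Odd ((quasiCylinderVertices n).filter fun u => (closedLadder n).Adj u (i, l)).card := by
  suffices ((quasiCylinderVertices n).filter fun u => (closedLadder n).Adj u (i, l)).card = 3 by
    rw [this]
    decide
  rw [mem_quasiCylinderVertices] at hv
  rw [Finset.card_eq_three]
  by_cases hi : i = n
  on_goal 1 => refine ⟨(n - 1, 0), (0, 0), (n, 1), ?_, ?_, ?_, ?_⟩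
  on_goal 5 => refine ⟨(i - 1, l), (i + 1, l), (i, 1 - l), ?_, ?_, ?_, ?_⟩
  all_goals
    first
    | ext ⟨a, b⟩
      simp only [Finset.mem_filter, mem_quasiCylinderVertices, closedLadder_adj,
        Finset.mem_insert, Finset.mem_singleton, Prod.mk.injEq]
      omega
    | rw [ne_eq, Prod.mk.injEq]
      omega

open Classical in
theorem realizable_quasiCylinderVertices {t : ℕ × ℕ → ZMod 2} (hn : 3 ≤ n) (hodd : Odd n)
    (hsum : ∑ v ∈ quasiCylinderVertices n, t v = (quasiCylinderVertices n).card)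
    (hsource : ∃ v ∈ quasiCylinderVertices n, t v = 0)
    (hsink : ∃ v ∈ quasiCylinderVertices n,
      (t v = 1 ∧
        Odd ((quasiCylinderVertices n).filter fun u => (closedLadder n).Adj u v).card) ∨
      (t v = 0 ∧
        Even ((quasiCylinderVertices n).filter fun u => (closedLadder n).Adj u v).card)) :
    Realizable (closedLadder n) (quasiCylinderVertices n) t := by
  by_cases h00 : t (0, 0) = 0
  · exact (alwaysRealizable_erase_hub hodd).realizable_of_erase
      (mem_quasiCylinderVertices.2 (by omega)) (even_card_neighbors hn (by simp)) h00 hsum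
  by_cases h11 : t (1, 1) = 0
  · exact (alwaysRealizable_erase_first_corner hn hodd).realizable_of_erase
      (mem_quasiCylinderVertices.2 (by omega)) (even_card_neighbors hn (by simp)) h11 hsum
  by_cases hn1 : t (n, 1) = 0
  · exact (alwaysRealizable_erase_last_corner hn hodd).realizable_of_erase
      (mem_quasiCylinderVertices.2 (by omega)) (even_card_neighbors hn (by simp)) hn1 hsum
  have hpair : ∀ i l j m, (i, l) ∈ quasiCylinderVertices n → (j, m) ∈ quasiCylinderVertices n →
      AlwaysRealizable (closedLadder n) (((quasiCylinderVertices n).erase (i, l)).erase (j, m)) →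
      (closedLadder n).Adj (i, l) (j, m) →
      i ≠ 0 → ¬(i = 1 ∧ l = 1) → ¬(i = n ∧ l = 1) →
      j ≠ 0 → ¬(j = 1 ∧ m = 1) → ¬(j = n ∧ m = 1) → t (i, l) ≠ t (j, m) →
      Realizable (closedLadder n) (quasiCylinderVertices n) t :=
    fun i l j m hv hw h hadj hi0 hi1 hin hj0 hj1 hjn hne =>
      h.realizable_of_erase_pair hv hw hadj (odd_card_neighbors hn hv hi0 hi1 hin)
        (odd_card_neighbors hn hw hj0 hj1 hjn) hne hsum
  have hn2 := Nat.odd_iff.1 hodd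
  by_cases hrow : ∃ i, 1 ≤ i ∧ i < n ∧ t (i, 0) ≠ t (i + 1, 0)
  · obtain ⟨i, hi, hin, hne⟩ := hrow
    refine hpair i 0 (i + 1) 0 (mem_quasiCylinderVertices.2 (by omega))
      (mem_quasiCylinderVertices.2 (by omega)) ?_ (closedLadder_adj.2 (by omega))
      (by omega) (by omega) (by omega) (by omega) (by omega) (by omega) hne
    rcases Nat.even_or_odd i with heven | hiodd
    · have hi2 := Nat.even_iff.1 heven
      by_cases hlast : i + 1 = n
      · subst hlast
        exact alwaysRealizable_erase_last_edge (by omega) heven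
      · exact alwaysRealizable_erase_inner_edge (by omega) (by omega) heven hodd (by omega)
    · have hi2 := Nat.odd_iff.1 hiodd
      exact alwaysRealizable_erase_odd_edge (by omega) hiodd hodd
  by_cases hrung : ∃ i, 2 ≤ i ∧ i < n ∧ Even i ∧ t (i, 0) ≠ t (i, 1)
  · obtain ⟨i, hi, hin, heven, hne⟩ := hrung
    exact hpair i 0 i 1 (mem_quasiCylinderVertices.2 (by omega))
      (mem_quasiCylinderVertices.2 (by omega)) (alwaysRealizable_erase_rung hi hin heven hodd)
      (closedLadder_adj.2 (by omega)) (by omega) (by omega) (by omega) (by omega) (by omega)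
      (by omega) hne
  by_cases hedge : ∃ i, 2 ≤ i ∧ i + 2 < n ∧ Even i ∧ t (i, 1) ≠ t (i + 1, 1)
  · obtain ⟨i, hi, hin, heven, hne⟩ := hedge
    exact hpair i 1 (i + 1) 1 (mem_quasiCylinderVertices.2 (by omega))
      (mem_quasiCylinderVertices.2 (by omega))
      (alwaysRealizable_erase_inner_edge hi hin heven hodd (by omega))
      (closedLadder_adj.2 (by omega)) (by omega) (by omega) (by omega) (by omega) (by omega)
      (by omega) hne
  exfalso
  push Not at hrow hrung hedge
  have hrow' : ∀ i, 1 ≤ i → i ≤ n → t (i, 0) = t (1, 0) := by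
    intro i hi
    induction i, hi using Nat.le_induction with
    | base => exact fun _ => rfl
    | succ i hi ih => exact fun hin => (hrow i hi (by omega)).symm.trans (ih (by omega))
  have hconst : ∀ i l, (i, l) ∈ quasiCylinderVertices n →
      ((i, l) = (0, 0) ∨ (i, l) = (1, 1) ∨ (i, l) = (n, 1)) ∨ t (i, l) = t (1, 0) := by
    intro i l hv
    rw [mem_quasiCylinderVertices] at hv
    simp only [Prod.mk.injEq, or_iff_not_imp_left]
    intro hexc
    obtain rfl | rfl : l = 0 ∨ l = 1 := by omega
    · exact hrow' i (by omega) (by omega)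
    · rcases Nat.even_or_odd i with heven | hiodd
      · have := Nat.even_iff.1 heven
        rw [← hrung i (by omega) (by omega) heven]
        exact hrow' i (by omega) (by omega)
      · obtain ⟨j, rfl⟩ := hiodd
        rw [← hedge (2 * j) (by omega) (by omega) (even_two_mul j),
          ← hrung (2 * j) (by omega) (by omega) (even_two_mul j)]
        exact hrow' (2 * j) (by omega) (by omega)
  have hexc : ∀ v : ℕ × ℕ, v = (0, 0) ∨ v = (1, 1) ∨ v = (n, 1) → t v ≠ 0 := by
    rintro v (rfl | rfl | rfl) <;> assumption
  obtain ⟨⟨i, l⟩, hv, hv0⟩ := hsource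
  have hc : t (1, 0) = 0 := by
    rw [← (hconst i l hv).resolve_left fun h => hexc _ h hv0, hv0]
  obtain ⟨⟨j, m⟩, hw, ⟨hw1, hwodd⟩ | ⟨hw0, hweven⟩⟩ := hsink
  · rcases hconst j m hw with h | h
    · exact Nat.not_even_iff_odd.2 hwodd (even_card_neighbors hn h)
    · rw [h, hc] at hw1
      exact zero_ne_one hw1
  · refine Nat.not_odd_iff_even.2 hweven ?_
    have := hexc (j, m)
    simp only [Prod.mk.injEq, hw0, ne_eq, not_true_eq_false, imp_false] at this
    have hw' := mem_quasiCylinderVertices.1 hw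
    exact odd_card_neighbors hn hw (by omega) (by omega) (by omega)

end Ladder

/-- The embedding of the quasi 2-cylinder into the vertices of the ladder. -/
def quasiCylinderEmbedding (p : ℕ) (x : Fin p × Fin 2) : {y : Fin p × Fin 2 // y ≠ x} ↪ ℕ × ℕ where
  toFun y := (y.1.1.val, y.1.2.val)
  inj' y z h := by
    rw [Prod.mk.injEq] at h
    exact Subtype.ext (Prod.ext (Fin.ext h.1) (Fin.ext h.2))

theorem quasiCylinderEmbedding_apply {p : ℕ} {x : Fin p × Fin 2}
    (y : {y : Fin p × Fin 2 // y ≠ x}) :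
    quasiCylinderEmbedding p x y = (y.1.1.val, y.1.2.val) :=
  rfl

theorem map_quasiCylinderEmbedding {n : ℕ} :
    Finset.univ.map (quasiCylinderEmbedding (n + 1) (0, 1)) =
      quasiCylinderVertices n := by
  ext ⟨i, l⟩
  simp only [Finset.mem_map, Finset.mem_univ, true_and, mem_quasiCylinderVertices]
  constructor
  · rintro ⟨⟨⟨a, b⟩, hab⟩, h⟩
    simp only [quasiCylinderEmbedding_apply, Prod.mk.injEq] at h
    simp only [ne_eq, Prod.mk.injEq, Fin.ext_iff, Fin.val_zero, Fin.val_one] at hab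
    omega
  · rintro ⟨hi, hl, h⟩
    refine ⟨⟨(⟨i, by omega⟩, ⟨l, hl⟩), ?_⟩, rfl⟩
    simp only [ne_eq, Prod.mk.injEq, Fin.ext_iff, Fin.val_zero, Fin.val_one]
    omega

theorem cycleGraph_adj_iff {n : ℕ} (hn : 2 ≤ n) (a b : Fin (n + 1)) :
    (cycleGraph (n + 1)).Adj a b ↔ (a.val + 1 = b.val ∨ b.val + 1 = a.val) ∨
      (a.val = 0 ∧ b.val = n) ∨ (a.val = n ∧ b.val = 0) := by
  rw [cycleGraph_adj']
  rcases lt_trichotomy a b with h | rfl | h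
  · rw [Fin.coe_sub_iff_lt.2 h, Fin.sub_val_of_le h.le]
    omega
  · simp only [sub_self, Fin.val_zero]
    omega
  · rw [Fin.coe_sub_iff_lt.2 h, Fin.sub_val_of_le h.le]
    omega

theorem quasiCylinder_adj_iff {n : ℕ} (hn : 2 ≤ n)
    (u v : {y : Fin (n + 1) × Fin 2 // y ≠ (0, 1)}) :
    ((cycleGraph (n + 1) □ pathGraph 2).induce
      {y : Fin (n + 1) × Fin 2 | y ≠ (0, 1)}).Adj u v ↔
      (closedLadder n).Adj (quasiCylinderEmbedding (n + 1) _ u)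
        (quasiCylinderEmbedding (n + 1) _ v) := by
  obtain ⟨⟨a, b⟩, hu⟩ := u
  obtain ⟨⟨c, d⟩, hv⟩ := v
  simp only [ne_eq, Prod.mk.injEq, Fin.ext_iff, Fin.val_zero, Fin.val_one] at hu hv
  rw [comap_adj, boxProd_adj]
  simp only [Function.Embedding.subtype_apply, cycleGraph_adj_iff hn, pathGraph_adj,
    quasiCylinderEmbedding_apply, closedLadder_adj, Fin.ext_iff]
  omega

theorem vdeg_eq_card_filter {V W : Type*} [Fintype V] [DecidableEq W] {H : SimpleGraph V}
    {G : SimpleGraph W} [DecidableRel G.Adj] (f : V ↪ W)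
    (hf : ∀ u v, H.Adj u v ↔ G.Adj (f u) (f v)) (v : V) :
    vdeg H v = ((Finset.univ.map f).filter fun u => G.Adj u (f v)).card := by
  rw [vdeg, ← Set.ncard_image_of_injective _ f.injective, ← Set.ncard_coe_finset]
  congr 1
  ext w
  simp only [Set.mem_image, mem_neighborSet, Finset.coe_filter, Finset.mem_map, Finset.mem_univ,
    true_and, Set.mem_ofPred_eq]
  constructor
  · rintro ⟨u, hu, rfl⟩
    exact ⟨⟨u, rfl⟩, (hf u v).1 hu.symm⟩
  · rintro ⟨⟨u, rfl⟩, hu⟩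
    exact ⟨u, ((hf u v).2 hu).symm, rfl⟩

theorem exists_parity {V W : Type*} (f : V ↪ W) (T : Set V) :
    ∃ t : W → ZMod 2, ∀ v, t (f v) = 1 ↔ v ∈ T := by
  classical
  refine ⟨fun w => if w ∈ f '' T then 1 else 0, fun v => ?_⟩
  simp

section Transfer

variable {V W : Type*} [Fintype V] {H : SimpleGraph V} {G : SimpleGraph W} {f : V ↪ W}

theorem sum_map_eq_ncard {t : W → ZMod 2} {T : Set V} (ht : ∀ v, t (f v) = 1 ↔ v ∈ T) :
    ∑ w ∈ Finset.univ.map f, t w = (T.ncard : ZMod 2) := by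
  rw [Finset.sum_map]
  exact (natCast_ncard_eq_sum ht).symm

theorem Realizable.sum_eq_ncard_edgeSet (hf : ∀ u v, H.Adj u v ↔ G.Adj (f u) (f v))
    {t : W → ZMod 2} (h : Realizable G (Finset.univ.map f) t) :
    ∑ w ∈ Finset.univ.map f, t w = (H.edgeSet.ncard : ZMod 2) := by
  have ht : ∀ v, t (f v) = 1 ↔ v ∈ {v | t (f v) = 1} := fun v => Iff.rfl
  rw [sum_map_eq_ncard ht]
  exact condP_iff.1 (h.hasAcyclicTOddOrientation f hf ht).condP

end Transfer

theorem memCP_quasiCylinder {n : ℕ} (hn : 3 ≤ n) (heven : Even n) :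
    MemCP ((cycleGraph (n + 1) □ pathGraph 2).induce
      {y : Fin (n + 1) × Fin 2 | y ≠ (0, 1)}) := by
  intro T hT
  have hA := alwaysRealizable_quasiCylinderVertices (by omega) heven
  have hE : Realizable (closedLadder n) (quasiCylinderVertices n) 0 := hA 0 (by
    rw [natCast_card_quasiCylinderVertices, CharTwo.add_self_eq_zero (1 : ZMod 2)]
    simp)
  rw [← map_quasiCylinderEmbedding] at hA hE
  obtain ⟨t, ht⟩ := exists_parity (quasiCylinderEmbedding (n + 1) (0, 1)) T
  refine (hA t ?_).hasAcyclicTOddOrientation _ (quasiCylinder_adj_iff (by omega)) ht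
  refine (sum_map_eq_ncard ht).trans ((condP_iff.1 hT).trans
    ((hE.sum_eq_ncard_edgeSet (quasiCylinder_adj_iff (by omega))).symm.trans ?_))
  rw [map_quasiCylinderEmbedding, natCast_card_quasiCylinderVertices,
    CharTwo.add_self_eq_zero (1 : ZMod 2)]
  simp

theorem memCPSSbar_quasiCylinder {n : ℕ} (hn : 3 ≤ n) (hodd : Odd n) :
    MemCPSSbar ((cycleGraph (n + 1) □ pathGraph 2).induce
      {y : Fin (n + 1) × Fin 2 | y ≠ (0, 1)}) := by
  classical
  rintro T hT ⟨⟨v, hv⟩, -⟩ ⟨⟨w, hw⟩, -⟩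
  have hadj := quasiCylinder_adj_iff (n := n) (by omega)
  have hE : Realizable (closedLadder n) (quasiCylinderVertices n) (Pi.single (1, 0) 1) :=
    (alwaysRealizable_erase_hub hodd).realizable_of_erase
      (mem_quasiCylinderVertices.2 (by omega)) (even_card_neighbors hn (by simp)) (by simp) (by
        rw [natCast_card_quasiCylinderVertices, Finset.sum_pi_single',
          if_pos (mem_quasiCylinderVertices.2 (by omega))])
  rw [← map_quasiCylinderEmbedding] at hE
  have hsum := hE.sum_eq_ncard_edgeSet hadj
  rw [map_quasiCylinderEmbedding, Finset.sum_pi_single',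
    if_pos (mem_quasiCylinderVertices.2 (by omega))] at hsum
  obtain ⟨t, ht⟩ := exists_parity (quasiCylinderEmbedding (n + 1) (0, 1)) T
  have ht0 : ∀ u, u ∉ T → t (quasiCylinderEmbedding (n + 1) _ u) = 0 := fun u hu =>
    (ZMod.two_eq_zero_or_one _).resolve_right fun h => hu ((ht u).1 h)
  have hmem : ∀ u : {y : Fin (n + 1) × Fin 2 // y ≠ (0, 1)},
      quasiCylinderEmbedding (n + 1) _ u ∈ quasiCylinderVertices n := fun u => by
    rw [← map_quasiCylinderEmbedding]
    exact Finset.mem_map_of_mem _ (Finset.mem_univ u)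
  have hdeg := vdeg_eq_card_filter _ hadj w
  rw [map_quasiCylinderEmbedding] at hdeg
  have h := realizable_quasiCylinderVertices (t := t) hn hodd ?_ ⟨_, hmem v, ht0 v hv⟩
    ⟨_, hmem w, ?_⟩
  · rw [← map_quasiCylinderEmbedding] at h
    exact h.hasAcyclicTOddOrientation _ hadj ht
  · rw [natCast_card_quasiCylinderVertices, ← map_quasiCylinderEmbedding]
    exact (sum_map_eq_ncard ht).trans ((condP_iff.1 hT).trans hsum.symm)
  · rcases hw with ⟨hwT, hw⟩ | ⟨hwT, hw⟩
    · exact Or.inl ⟨(ht w).2 hwT, by convert hdeg ▸ hw⟩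
    · exact Or.inr ⟨ht0 w hwT, by convert hdeg ▸ hw⟩

/-- Lemma (quasi 2-cylinders): the graph obtained from `C_p □ P_2` (`p ≥ 4`) by removing
the vertex `(u_0, v_1)` admits an acyclic `T`-odd orientation for every `T` satisfying
`𝒫` when `p` is odd, and `𝒫 𝒮 𝒮̄` when `p` is even. -/
theorem quasi_two_cylinder (p : ℕ) (hp : 4 ≤ p) :
    (Odd p → ∀ T : Set {y : Fin p × Fin 2 // y ≠ ((⟨0, by omega⟩ : Fin p), (⟨1, by omega⟩ : Fin 2))},
      CondP ((cycleGraph p □ pathGraph 2).induce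
        {y : Fin p × Fin 2 | y ≠ ((⟨0, by omega⟩ : Fin p), (⟨1, by omega⟩ : Fin 2))}) T →
      HasAcyclicTOddOrientation ((cycleGraph p □ pathGraph 2).induce
        {y : Fin p × Fin 2 | y ≠ ((⟨0, by omega⟩ : Fin p), (⟨1, by omega⟩ : Fin 2))}) T) ∧
    (Even p → ∀ T : Set {y : Fin p × Fin 2 // y ≠ ((⟨0, by omega⟩ : Fin p), (⟨1, by omega⟩ : Fin 2))},
      CondP ((cycleGraph p □ pathGraph 2).induce
        {y : Fin p × Fin 2 | y ≠ ((⟨0, by omega⟩ : Fin p), (⟨1, by omega⟩ : Fin 2))}) T →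
      CondS ((cycleGraph p □ pathGraph 2).induce
        {y : Fin p × Fin 2 | y ≠ ((⟨0, by omega⟩ : Fin p), (⟨1, by omega⟩ : Fin 2))}) T →
      CondSbar ((cycleGraph p □ pathGraph 2).induce
        {y : Fin p × Fin 2 | y ≠ ((⟨0, by omega⟩ : Fin p), (⟨1, by omega⟩ : Fin 2))}) T →
      HasAcyclicTOddOrientation ((cycleGraph p □ pathGraph 2).induce
        {y : Fin p × Fin 2 | y ≠ ((⟨0, by omega⟩ : Fin p), (⟨1, by omega⟩ : Fin 2))}) T) := by
  obtain ⟨n, rfl⟩ : ∃ n, p = n + 1 := ⟨p - 1, by omega⟩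
  exact ⟨fun h => memCP_quasiCylinder (by omega) (by simpa [parity_simps] using h),
    fun h => memCPSSbar_quasiCylinder (by omega) (by simpa [parity_simps] using h)⟩
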